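/- arXiv:1710.04292 — 9 statements merged into one kernel-verified Lean document; each statement's English description precedes it below -/
import Mathlib

section
/- Jump in the velocity sensitivity at an event with an impulsive velocity jump. Let n, p be positive integers, ρ₀ ∈ ℝ^p, τ : ℝ^p → ℝ differentiable at ρ₀ with t* := τ(ρ₀). Let q⁻ : ℝ × ℝ^p → ℝ^n be differentiable at (t*, ρ₀) with Q⁻ := ∂q⁻/∂ρ(t*,ρ₀) and ∂q⁻/∂t(t*,ρ₀) = v⁻ where v⁻ is as below. Let v⁻, v⁺ : ℝ × ℝ^p → ℝ^n (pre- and post-event velocity trajectories) be differentiable at (t*, ρ₀), with accelerations a± := ∂v±/∂t(t*,ρ₀) ∈ ℝ^n and velocity sensitivities V± := ∂v±/∂ρ(t*,ρ₀) ∈ L(ℝ^p, ℝ^n); write v⁻ also for v⁻(t*,ρ₀). Let the jump function h : ℝ × ℝ^n × ℝ^n × ℝ^p → ℝ^n be differentiable at (t*, q⁻(t*,ρ₀), v⁻(t*,ρ₀), ρ₀) with partial derivatives h_t ∈ ℝ^n, h_q, h_v ∈ L(ℝ^n, ℝ^n), h_ρ ∈ L(ℝ^p, ℝ^n) there. Assume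 the jump condition v⁺(τ(ρ), ρ) = h(τ(ρ), q⁻(τ(ρ), ρ), v⁻(τ(ρ), ρ), ρ) holds for all ρ in a neighborhood of ρ₀. Then for every δρ ∈ ℝ^p, V⁺(δρ) = h_q(Q⁻(δρ)) + h_v(V⁻(δρ)) + (h_q(v⁻) − a⁺ + h_v(a⁻) + h_t) · (Dτ(ρ₀)(δρ)) + h_ρ(δρ). -/
open scoped Topology

/-- **Jump in the velocity sensitivity at an event with an impulsive velocity jump.**
If the post-event velocity satisfies `v⁺(τ ρ, ρ) = h (τ ρ, q⁻(τ ρ, ρ), v⁻(τ ρ, ρ), ρ)` for all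
`ρ` near `ρ₀`, then the velocity sensitivity jumps according to
`V⁺(δρ) = h_q (Q⁻ δρ) + h_v (V⁻ δρ) + (Dτ(ρ₀)(δρ)) • (h_q v⁻ − a⁺ + h_v a⁻ + h_t) + h_ρ δρ`. -/
theorem velocity_sensitivity_jump
    {n p : ℕ} (hn : 0 < n) (hp : 0 < p)
    (ρ₀ : Fin p → ℝ)
    (τ : (Fin p → ℝ) → ℝ) (Dτ : (Fin p → ℝ) →L[ℝ] ℝ)
    (hτ : HasFDerivAt τ Dτ ρ₀)
    (qm : ℝ × (Fin p → ℝ) → Fin n → ℝ)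
    (Dqm : (ℝ × (Fin p → ℝ)) →L[ℝ] (Fin n → ℝ))
    (hqm : HasFDerivAt qm Dqm (τ ρ₀, ρ₀))
    (vm vp : ℝ × (Fin p → ℝ) → Fin n → ℝ)
    (Dvm Dvp : (ℝ × (Fin p → ℝ)) →L[ℝ] (Fin n → ℝ))
    (hvm : HasFDerivAt vm Dvm (τ ρ₀, ρ₀))
    (hvp : HasFDerivAt vp Dvp (τ ρ₀, ρ₀))
    (hqt : Dqm (1, 0) = vm (τ ρ₀, ρ₀))
    (am ap : Fin n → ℝ) (ham : am = Dvm (1, 0)) (hap : ap = Dvp (1, 0))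
    (Qm Vm Vp : (Fin p → ℝ) →L[ℝ] (Fin n → ℝ))
    (hQm : ∀ δρ, Qm δρ = Dqm (0, δρ))
    (hVm : ∀ δρ, Vm δρ = Dvm (0, δρ))
    (hVp : ∀ δρ, Vp δρ = Dvp (0, δρ))
    (h : ℝ × (Fin n → ℝ) × (Fin n → ℝ) × (Fin p → ℝ) → Fin n → ℝ)
    (Dh : (ℝ × (Fin n → ℝ) × (Fin n → ℝ) × (Fin p → ℝ)) →L[ℝ] (Fin n → ℝ))
    (hh : HasFDerivAt h Dh (τ ρ₀, qm (τ ρ₀, ρ₀), vm (τ ρ₀, ρ₀), ρ₀))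
    (hjt : Fin n → ℝ) (hhjt : hjt = Dh (1, 0, 0, 0))
    (hjq : (Fin n → ℝ) →L[ℝ] (Fin n → ℝ)) (hhjq : ∀ u, hjq u = Dh (0, u, 0, 0))
    (hjv : (Fin n → ℝ) →L[ℝ] (Fin n → ℝ)) (hhjv : ∀ u, hjv u = Dh (0, 0, u, 0))
    (hjρ : (Fin p → ℝ) →L[ℝ] (Fin n → ℝ)) (hhjρ : ∀ u, hjρ u = Dh (0, 0, 0, u))
    (hjump : ∀ᶠ ρ in 𝓝 ρ₀, vp (τ ρ, ρ) = h (τ ρ, qm (τ ρ, ρ), vm (τ ρ, ρ), ρ)) :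
    ∀ δρ : Fin p → ℝ,
      Vp δρ = hjq (Qm δρ) + hjv (Vm δρ)
        + Dτ δρ • (hjq (vm (τ ρ₀, ρ₀)) - ap + hjv am + hjt) + hjρ δρ := by
  intro δρ
  have hg : HasFDerivAt (fun ρ => (τ ρ, ρ)) (Dτ.prod (ContinuousLinearMap.id ℝ (Fin p → ℝ))) ρ₀ :=
    hτ.prodMk (hasFDerivAt_id ρ₀)
  have hq1 := HasFDerivAt.comp (f := fun ρ => (τ ρ, ρ)) ρ₀ hqm hg
  have hv1 := HasFDerivAt.comp (f := fun ρ => (τ ρ, ρ)) ρ₀ hvm hg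
  have hp1 := HasFDerivAt.comp (f := fun ρ => (τ ρ, ρ)) ρ₀ hvp hg
  have hin := hτ.prodMk (hq1.prodMk (hv1.prodMk (hasFDerivAt_id ρ₀)))
  have hh1 := HasFDerivAt.comp ρ₀ (g := h) (g' := Dh) hh hin
  have key := hp1.unique (hh1.congr_of_eventuallyEq hjump)
  have key2 := congrArg (fun L : (Fin p → ℝ) →L[ℝ] (Fin n → ℝ) => L δρ) key
  have split2 : ∀ (D : (ℝ × (Fin p → ℝ)) →L[ℝ] (Fin n → ℝ)) (s : ℝ) (x : Fin p → ℝ),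
      D (s, x) = s • D (1, 0) + D (0, x) := by
    intro D s x
    rw [← map_smul, ← map_add]
    simp
  have split4 : ∀ (s : ℝ) (a b : Fin n → ℝ) (x : Fin p → ℝ),
      Dh (s, a, b, x) = s • hjt + hjq a + hjv b + hjρ x := by
    intro s a b x
    rw [hhjt, hhjq, hhjv, hhjρ, ← map_smul, ← map_add, ← map_add, ← map_add]
    simp
  have key3 : Dvp (Dτ δρ, δρ) = Dh (Dτ δρ, Dqm (Dτ δρ, δρ), Dvm (Dτ δρ, δρ), δρ) := key2
  rw [split4, split2 Dvp, split2 Dqm, split2 Dvm, hqt, ← ham, ← hap, ← hQm, ← hVm, ← hVp] at key3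
  simp only [map_add, map_smul] at key3
  rw [eq_sub_of_add_eq' key3]
  module
end

section
/- Jump in the velocity sensitivity for events that only change the acceleration (discontinuous right-hand side, continuous velocity). Let n, p be positive integers, ρ₀ ∈ ℝ^p, τ : ℝ^p → ℝ differentiable at ρ₀ with t* := τ(ρ₀). Let v⁻, v⁺ : ℝ × ℝ^p → ℝ^n be differentiable at (t*, ρ₀), with accelerations a± := ∂v±/∂t(t*,ρ₀) and velocity sensitivities V± := ∂v±/∂ρ(t*,ρ₀) ∈ L(ℝ^p, ℝ^n). Assume the velocity is continuous across the event: v⁺(τ(ρ), ρ) = v⁻(τ(ρ), ρ) for all ρ in a neighborhood of ρ₀. Then for every δρ ∈ ℝ^p, V⁺(δρ) = V⁻(δρ) − (a⁺ − a⁻) · (Dτ(ρ₀)(δρ)). -/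
open scoped Topology

/-- **Jump in the velocity sensitivity for events that only change the acceleration.**
If the velocity trajectory is continuous across the event, `v⁺(τ ρ, ρ) = v⁻(τ ρ, ρ)` for `ρ`
near `ρ₀`, then the velocity sensitivities satisfy
`V⁺(δρ) = V⁻(δρ) − (Dτ(ρ₀)(δρ)) • (a⁺ − a⁻)`. -/
theorem velocity_sensitivity_jump_acceleration_change
    {n p : ℕ} (hn : 0 < n) (hp : 0 < p)
    (ρ₀ : Fin p → ℝ)
    (τ : (Fin p → ℝ) → ℝ) (Dτ : (Fin p → ℝ) →L[ℝ] ℝ)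
    (hτ : HasFDerivAt τ Dτ ρ₀)
    (vm vp : ℝ × (Fin p → ℝ) → Fin n → ℝ)
    (Dvm Dvp : (ℝ × (Fin p → ℝ)) →L[ℝ] (Fin n → ℝ))
    (hvm : HasFDerivAt vm Dvm (τ ρ₀, ρ₀))
    (hvp : HasFDerivAt vp Dvp (τ ρ₀, ρ₀))
    (am ap : Fin n → ℝ) (ham : am = Dvm (1, 0)) (hap : ap = Dvp (1, 0))
    (Vm Vp : (Fin p → ℝ) →L[ℝ] (Fin n → ℝ))
    (hVm : ∀ δρ, Vm δρ = Dvm (0, δρ))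
    (hVp : ∀ δρ, Vp δρ = Dvp (0, δρ))
    (hcont : ∀ᶠ ρ in 𝓝 ρ₀, vp (τ ρ, ρ) = vm (τ ρ, ρ)) :
    ∀ δρ : Fin p → ℝ, Vp δρ = Vm δρ - Dτ δρ • (ap - am) := by
  intro δρ
  have hg : HasFDerivAt (fun ρ => (τ ρ, ρ)) (Dτ.prod (ContinuousLinearMap.id ℝ (Fin p → ℝ))) ρ₀ :=
    hτ.prodMk (hasFDerivAt_id ρ₀)
  have h1 := HasFDerivAt.comp (g := vp) (f := fun ρ => (τ ρ, ρ)) ρ₀ hvp hg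
  have h2 := HasFDerivAt.comp (g := vm) (f := fun ρ => (τ ρ, ρ)) ρ₀ hvm hg
  have h3 := h2.congr_of_eventuallyEq (f₁ := vp ∘ fun ρ => (τ ρ, ρ)) hcont
  have h4 : Dvp (Dτ δρ, δρ) = Dvm (Dτ δρ, δρ) := by
    have := congrArg (fun L => L δρ) (h1.unique h3)
    simpa using this
  have key : ∀ D : (ℝ × (Fin p → ℝ)) →L[ℝ] (Fin n → ℝ),
      D (Dτ δρ, δρ) = Dτ δρ • D (1, 0) + D (0, δρ) := by
    intro D
    rw [← map_smul, ← map_add]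
    simp
  rw [key, key] at h4
  rw [hVm, hVp, ham, hap, smul_sub, eq_sub_iff_add_eq, ← sub_eq_zero]
  rw [← sub_eq_zero] at h4
  rw [← h4]
  abel
end

section
/- Jump in the quadrature (running-cost) sensitivity at an event. Let p be a positive integer, ρ₀ ∈ ℝ^p, τ : ℝ^p → ℝ differentiable at ρ₀ with t* := τ(ρ₀). Let z⁻, z⁺ : ℝ × ℝ^p → ℝ be differentiable at (t*, ρ₀), with g± := ∂z±/∂t(t*,ρ₀) ∈ ℝ and Z± := ∂z±/∂ρ(t*,ρ₀) ∈ L(ℝ^p, ℝ). Assume the quadrature variable is continuous across the event: z⁻(τ(ρ), ρ) = z⁺(τ(ρ), ρ) for all ρ in a neighborhood of ρ₀. Then for every δρ ∈ ℝ^p, Z⁺(δρ) = Z⁻(δρ) − (g⁺ − g⁻) · (Dτ(ρ₀)(δρ)). -/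
open scoped Topology

/-- **Jump in the quadrature (running-cost) sensitivity at an event.**
If the quadrature variable is continuous across the event, `z⁺(τ ρ, ρ) = z⁻(τ ρ, ρ)` for `ρ`
near `ρ₀`, then its parameter sensitivities satisfy
`Z⁺(δρ) = Z⁻(δρ) − (g⁺ − g⁻) · (Dτ(ρ₀)(δρ))` where `g± = ∂z±/∂t`. -/
theorem quadrature_sensitivity_jump
    {p : ℕ} (hp : 0 < p)
    (ρ₀ : Fin p → ℝ)
    (τ : (Fin p → ℝ) → ℝ) (Dτ : (Fin p → ℝ) →L[ℝ] ℝ)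
    (hτ : HasFDerivAt τ Dτ ρ₀)
    (zm zp : ℝ × (Fin p → ℝ) → ℝ)
    (Dzm Dzp : (ℝ × (Fin p → ℝ)) →L[ℝ] ℝ)
    (hzm : HasFDerivAt zm Dzm (τ ρ₀, ρ₀))
    (hzp : HasFDerivAt zp Dzp (τ ρ₀, ρ₀))
    (gm gp : ℝ) (hgm : gm = Dzm (1, 0)) (hgp : gp = Dzp (1, 0))
    (Zm Zp : (Fin p → ℝ) →L[ℝ] ℝ)
    (hZm : ∀ δρ, Zm δρ = Dzm (0, δρ))
    (hZp : ∀ δρ, Zp δρ = Dzp (0, δρ))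
    (hcont : ∀ᶠ ρ in 𝓝 ρ₀, zm (τ ρ, ρ) = zp (τ ρ, ρ)) :
    ∀ δρ : Fin p → ℝ, Zp δρ = Zm δρ - (gp - gm) * Dτ δρ := by
  intro δρ
  have hpair : HasFDerivAt (fun ρ => (τ ρ, ρ)) (Dτ.prod (ContinuousLinearMap.id ℝ (Fin p → ℝ))) ρ₀ :=
    hτ.prodMk (hasFDerivAt_id ρ₀)
  have h1 := HasFDerivAt.comp (g := zm) (f := fun ρ => (τ ρ, ρ)) ρ₀ hzm hpair
  have h2 := HasFDerivAt.comp (g := zp) (f := fun ρ => (τ ρ, ρ)) ρ₀ hzp hpair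
  have h3 := h2.congr_of_eventuallyEq (f₁ := zm ∘ fun ρ => (τ ρ, ρ)) hcont
  have h4 := congrArg (fun L => L δρ) (h1.unique h3)
  have key : ∀ D : (ℝ × (Fin p → ℝ)) →L[ℝ] ℝ,
      D (Dτ δρ, δρ) = Dτ δρ * D (1, 0) + D (0, δρ) := by
    intro D
    rw [← smul_eq_mul, ← map_smul, ← map_add]
    simp
  have h5 : Dzm (Dτ δρ, δρ) = Dzp (Dτ δρ, δρ) := h4
  rw [key, key] at h5
  rw [hZm, hZp, hgm, hgp]
  linarith
end

section
/- Jump in the position sensitivity of the independent coordinates for a constrained system. Let n, f, p be positive integers, ρ₀ ∈ ℝ^p, τ : ℝ^p → ℝ differentiable at ρ₀ with t* := τ(ρ₀). Let q⁻, q⁺ : ℝ × ℝ^p → ℝ^n be differentiable at (t*, ρ₀) with q⁻(τ(ρ), ρ) = q⁺(τ(ρ), ρ) for all ρ in a neighborhood of ρ₀, and denote v± := ∂q±/∂t(t*,ρ₀), Q± := ∂q±/∂ρ(t*,ρ₀). Let P : ℝ^n → ℝ^f be any linear map (the selection of the independent, degree-of-freedom, coordinates). Then for every δρ ∈ ℝ^p,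 P(Q⁺(δρ)) = P(Q⁻(δρ)) − P(v⁺ − v⁻) · (Dτ(ρ₀)(δρ)). -/
open scoped Topology

/-- **Jump in the position sensitivity of the independent coordinates for a constrained
system.** With position continuity `q⁻(τ ρ, ρ) = q⁺(τ ρ, ρ)` across the event and any linear
selection map `P : ℝⁿ → ℝᶠ` of the independent (degree-of-freedom) coordinates,
`P(Q⁺ δρ) = P(Q⁻ δρ) − (Dτ(ρ₀)(δρ)) • P(v⁺ − v⁻)`. -/
theorem constrained_position_sensitivity_jump_dof
    {n f p : ℕ} (hn : 0 < n) (hf : 0 < f) (hp : 0 < p)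
    (ρ₀ : Fin p → ℝ)
    (τ : (Fin p → ℝ) → ℝ) (Dτ : (Fin p → ℝ) →L[ℝ] ℝ)
    (hτ : HasFDerivAt τ Dτ ρ₀)
    (qm qp : ℝ × (Fin p → ℝ) → Fin n → ℝ)
    (Dqm Dqp : (ℝ × (Fin p → ℝ)) →L[ℝ] (Fin n → ℝ))
    (hqm : HasFDerivAt qm Dqm (τ ρ₀, ρ₀))
    (hqp : HasFDerivAt qp Dqp (τ ρ₀, ρ₀))
    (hmatch : ∀ᶠ ρ in 𝓝 ρ₀, qm (τ ρ, ρ) = qp (τ ρ, ρ))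
    (vm vp : Fin n → ℝ) (hvm : vm = Dqm (1, 0)) (hvp : vp = Dqp (1, 0))
    (Qm Qp : (Fin p → ℝ) →L[ℝ] (Fin n → ℝ))
    (hQm : ∀ δρ, Qm δρ = Dqm (0, δρ)) (hQp : ∀ δρ, Qp δρ = Dqp (0, δρ))
    (P : (Fin n → ℝ) →ₗ[ℝ] (Fin f → ℝ)) :
    ∀ δρ : Fin p → ℝ, P (Qp δρ) = P (Qm δρ) - Dτ δρ • P (vp - vm) := by
  intro δ
  have hg : HasFDerivAt (fun ρ => (τ ρ, ρ)) (Dτ.prod (ContinuousLinearMap.id ℝ (Fin p → ℝ))) ρ₀ :=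
    hτ.prodMk (hasFDerivAt_id ρ₀)
  have h1 := HasFDerivAt.comp (g := qm) (f := fun ρ => (τ ρ, ρ)) ρ₀ hqm hg
  have h2 := HasFDerivAt.comp (g := qp) (f := fun ρ => (τ ρ, ρ)) ρ₀ hqp hg
  have h3 := h1.unique (h2.congr_of_eventuallyEq hmatch)
  have h4 : Dqm (Dτ δ, δ) = Dqp (Dτ δ, δ) := DFunLike.congr_fun h3 δ
  have key : ∀ D : (ℝ × (Fin p → ℝ)) →L[ℝ] (Fin n → ℝ),
      D (Dτ δ, δ) = Dτ δ • D (1, 0) + D (0, δ) := by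
    intro D
    rw [← map_smul, ← map_add]
    simp
  rw [key, key, ← hvm, ← hvp, ← hQm, ← hQp] at h4
  have h5 : Qp δ = Qm δ - Dτ δ • (vp - vm) := by
    rw [smul_sub, eq_sub_iff_add_eq, ← sub_eq_zero]
    rw [← sub_eq_zero] at h4
    rw [← neg_eq_zero, ← h4]
    abel
  rw [h5, map_sub, map_smul]
end

section
/- Jump in the velocity sensitivity of the independent coordinates for a constrained system. Let n, p and f⁻, f⁺ be positive integers, ρ₀ ∈ ℝ^p, τ : ℝ^p → ℝ differentiable at ρ₀ with t* := τ(ρ₀). Let q⁻ : ℝ × ℝ^p → ℝ^n be differentiable at (t*, ρ₀) with Q⁻ := ∂q⁻/∂ρ(t*,ρ₀) and ∂q⁻/∂t(t*,ρ₀) = v⁻(t*,ρ₀). Let v⁻, v⁺ : ℝ × ℝ^p → ℝ^n be differentiable at (t*, ρ₀) with accelerations a± := ∂v±/∂t(t*,ρ₀) and velocity sensitivities V± := ∂v±/∂ρ(t*,ρ₀). Let P⁻ : ℝ^n → ℝ^{f⁻} and P⁺ : ℝ^n → ℝ^{f⁺} be linear maps (selections of the independent velocity coordinates before and after the event). Let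 h : ℝ × ℝ^n × ℝ^{f⁻} × ℝ^p → ℝ^{f⁺} be differentiable at (t*, q⁻(t*,ρ₀), P⁻(v⁻(t*,ρ₀)), ρ₀), with partial derivatives h_t ∈ ℝ^{f⁺}, h_q ∈ L(ℝ^n, ℝ^{f⁺}), h_w ∈ L(ℝ^{f⁻}, ℝ^{f⁺}), h_ρ ∈ L(ℝ^p, ℝ^{f⁺}) there. Assume the jump condition on the independent velocities: P⁺(v⁺(τ(ρ), ρ)) = h(τ(ρ), q⁻(τ(ρ), ρ), P⁻(v⁻(τ(ρ), ρ)), ρ) for all ρ in a neighborhood of ρ₀. Then for every δρ ∈ ℝ^p, P⁺(V⁺(δρ)) = h_q(Q⁻(δρ)) + h_w(P⁻(V⁻(δρ))) + (h_q(v⁻) − P⁺(a⁺) + h_w(P⁻(a⁻)) + h_t) · (Dτ(ρ₀)(δρ)) + h_ρ(δρ). -/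
open scoped Topology

/-- **Jump in the velocity sensitivity of the independent coordinates for a constrained
system.** With selection maps `P⁻ : ℝⁿ → ℝ^{f⁻}`, `P⁺ : ℝⁿ → ℝ^{f⁺}` of the independent
velocity components before and after the event, and jump condition
`P⁺(v⁺(τ ρ, ρ)) = h (τ ρ, q⁻(τ ρ, ρ), P⁻(v⁻(τ ρ, ρ)), ρ)` near `ρ₀`, one has
`P⁺(V⁺ δρ) = h_q (Q⁻ δρ) + h_w (P⁻ (V⁻ δρ))
  + (Dτ(ρ₀)(δρ)) • (h_q v⁻ − P⁺ a⁺ + h_w (P⁻ a⁻) + h_t) + h_ρ δρ`. -/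
theorem constrained_velocity_sensitivity_jump_dof
    {n p fm fp : ℕ} (hn : 0 < n) (hp : 0 < p) (hfm : 0 < fm) (hfp : 0 < fp)
    (ρ₀ : Fin p → ℝ)
    (τ : (Fin p → ℝ) → ℝ) (Dτ : (Fin p → ℝ) →L[ℝ] ℝ)
    (hτ : HasFDerivAt τ Dτ ρ₀)
    (qm : ℝ × (Fin p → ℝ) → Fin n → ℝ)
    (Dqm : (ℝ × (Fin p → ℝ)) →L[ℝ] (Fin n → ℝ))
    (hqm : HasFDerivAt qm Dqm (τ ρ₀, ρ₀))
    (vm vp : ℝ × (Fin p → ℝ) → Fin n → ℝ)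
    (Dvm Dvp : (ℝ × (Fin p → ℝ)) →L[ℝ] (Fin n → ℝ))
    (hvm : HasFDerivAt vm Dvm (τ ρ₀, ρ₀))
    (hvp : HasFDerivAt vp Dvp (τ ρ₀, ρ₀))
    (hqt : Dqm (1, 0) = vm (τ ρ₀, ρ₀))
    (am ap : Fin n → ℝ) (ham : am = Dvm (1, 0)) (hap : ap = Dvp (1, 0))
    (Qm Vm Vp : (Fin p → ℝ) →L[ℝ] (Fin n → ℝ))
    (hQm : ∀ δρ, Qm δρ = Dqm (0, δρ))
    (hVm : ∀ δρ, Vm δρ = Dvm (0, δρ))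
    (hVp : ∀ δρ, Vp δρ = Dvp (0, δρ))
    (Pm : (Fin n → ℝ) →ₗ[ℝ] (Fin fm → ℝ))
    (Pp : (Fin n → ℝ) →ₗ[ℝ] (Fin fp → ℝ))
    (h : ℝ × (Fin n → ℝ) × (Fin fm → ℝ) × (Fin p → ℝ) → Fin fp → ℝ)
    (Dh : (ℝ × (Fin n → ℝ) × (Fin fm → ℝ) × (Fin p → ℝ)) →L[ℝ] (Fin fp → ℝ))
    (hh : HasFDerivAt h Dh (τ ρ₀, qm (τ ρ₀, ρ₀), Pm (vm (τ ρ₀, ρ₀)), ρ₀))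
    (hjt : Fin fp → ℝ) (hhjt : hjt = Dh (1, 0, 0, 0))
    (hjq : (Fin n → ℝ) →L[ℝ] (Fin fp → ℝ)) (hhjq : ∀ u, hjq u = Dh (0, u, 0, 0))
    (hjw : (Fin fm → ℝ) →L[ℝ] (Fin fp → ℝ)) (hhjw : ∀ u, hjw u = Dh (0, 0, u, 0))
    (hjρ : (Fin p → ℝ) →L[ℝ] (Fin fp → ℝ)) (hhjρ : ∀ u, hjρ u = Dh (0, 0, 0, u))
    (hjump : ∀ᶠ ρ in 𝓝 ρ₀,
      Pp (vp (τ ρ, ρ)) = h (τ ρ, qm (τ ρ, ρ), Pm (vm (τ ρ, ρ)), ρ)) :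
    ∀ δρ : Fin p → ℝ,
      Pp (Vp δρ) = hjq (Qm δρ) + hjw (Pm (Vm δρ))
        + Dτ δρ • (hjq (vm (τ ρ₀, ρ₀)) - Pp ap + hjw (Pm am) + hjt) + hjρ δρ := by
  intro δρ
  have hg : HasFDerivAt (fun ρ => (τ ρ, ρ)) (Dτ.prod (ContinuousLinearMap.id ℝ (Fin p → ℝ))) ρ₀ :=
    hτ.prodMk (hasFDerivAt_id ρ₀)
  have hq := HasFDerivAt.comp (f := fun ρ => (τ ρ, ρ)) ρ₀ hqm hg
  have hv := HasFDerivAt.comp (f := fun ρ => (τ ρ, ρ)) ρ₀ hvm hg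
  have hv2 := HasFDerivAt.comp (f := fun ρ => (τ ρ, ρ)) ρ₀ hvp hg
  have hPv := HasFDerivAt.comp ρ₀ (LinearMap.toContinuousLinearMap Pm).hasFDerivAt hv
  have hL := HasFDerivAt.comp ρ₀ (LinearMap.toContinuousLinearMap Pp).hasFDerivAt hv2
  have hin := hτ.prodMk (hq.prodMk (hPv.prodMk (hasFDerivAt_id ρ₀)))
  have hR := HasFDerivAt.comp (f := fun ρ => (τ ρ, qm (τ ρ, ρ), Pm (vm (τ ρ, ρ)), ρ)) ρ₀ hh hin
  have hL2 := hR.congr_of_eventuallyEq (f₁ := fun ρ => Pp (vp (τ ρ, ρ))) hjump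
  have e := congrArg (fun L => L δρ) (hL.unique hL2)
  have split : ∀ (D : (ℝ × (Fin p → ℝ)) →L[ℝ] (Fin n → ℝ)),
      D (Dτ δρ, δρ) = Dτ δρ • D (1, 0) + D (0, δρ) := by
    intro D
    rw [← map_smul, ← map_add]
    simp
  have e' : Pp (Dvp (Dτ δρ, δρ))
      = Dh (Dτ δρ, Dqm (Dτ δρ, δρ), Pm (Dvm (Dτ δρ, δρ)), δρ) := e
  have splith : ∀ (t : ℝ) u w r, Dh (t, u, w, r) = t • hjt + hjq u + hjw w + hjρ r := by
    intro t u w r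
    rw [hhjt, hhjq, hhjw, hhjρ, ← map_smul, ← map_add, ← map_add, ← map_add]
    simp
  rw [splith, split, split, split, hqt, ← ham, ← hap, ← hQm, ← hVm, ← hVp] at e'
  simp only [map_add, map_smul] at e'
  rw [← eq_sub_iff_add_eq'] at e'
  rw [e']
  module
end

section
/- Dependent velocity sensitivities from the differentiated velocity constraint. Let m, f, p be positive integers and identify ℝ^{m+f} = ℝ^m × ℝ^f. Let Φ : ℝ × (ℝ^m × ℝ^f) × ℝ^p → ℝ^m be twice continuously differentiable near (t₀, q(t₀,ρ₀), ρ₀). Let q : ℝ × ℝ^p → ℝ^m × ℝ^f be differentiable near (t₀,ρ₀) with velocity v(t,ρ) := ∂q/∂t(t,ρ), and assume v is differentiable at (t₀,ρ₀). Assume the velocity-level constraint holds identically: ∂Φ/∂q(t, q(t,ρ), ρ) · v(t,ρ) + ∂Φ/∂t(t, q(t,ρ), ρ) = 0 for all (t,ρ) in a neighborhood of (t₀, ρ₀). At the point (t₀, q(t₀,ρ₀), ρ₀) denote A := ∂Φ/∂q_dep (assumed invertible), B := ∂Φ/∂q_dof, R := −A⁻¹ ∘ B, Q := ∂q/∂ρ(t₀,ρ₀),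 V := ∂v/∂ρ(t₀,ρ₀) = (V_dep, V_dof), and let Φ_qq, Φ_qρ (= Φ_ρq), Φ_tq, Φ_tρ denote the indicated second partial derivatives of Φ there. Then for every δρ ∈ ℝ^p, V_dep(δρ) = R(V_dof(δρ)) − A⁻¹( Φ_qq(Q(δρ), v(t₀,ρ₀)) + Φ_qρ(δρ, v(t₀,ρ₀)) + Φ_tq(Q(δρ)) + Φ_tρ(δρ) ). -/
open scoped Topology

/-- **Dependent velocity sensitivities from the differentiated velocity constraint.**
If the velocity-level constraint `Φ_q(t, q(t,ρ), ρ) · v(t,ρ) + Φ_t(t, q(t,ρ), ρ) = 0` holds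
near `(t₀, ρ₀)`, with `A = ∂Φ/∂q_dep` invertible, `B = ∂Φ/∂q_dof`, `R = −A⁻¹ ∘ B`, then the
dependent velocity sensitivities satisfy
`V_dep δρ = R (V_dof δρ) − A⁻¹ (Φ_qq (Q δρ, v) + Φ_qρ (δρ, v) + Φ_tq (Q δρ) + Φ_tρ (δρ))`,
where the second partial derivatives of `Φ` are read off from the second Fréchet derivative
`D2` of `Φ` at `(t₀, q(t₀,ρ₀), ρ₀)`. -/
theorem dependent_velocity_sensitivities
    {m f p : ℕ} (hm : 0 < m) (hf : 0 < f) (hp : 0 < p)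
    (t₀ : ℝ) (ρ₀ : Fin p → ℝ)
    (q : ℝ × (Fin p → ℝ) → (Fin m → ℝ) × (Fin f → ℝ))
    (hqdiff : ∀ᶠ x in 𝓝 (t₀, ρ₀), DifferentiableAt ℝ q x)
    (Dq : (ℝ × (Fin p → ℝ)) →L[ℝ] ((Fin m → ℝ) × (Fin f → ℝ)))
    (hDq : HasFDerivAt q Dq (t₀, ρ₀))
    (v : ℝ × (Fin p → ℝ) → (Fin m → ℝ) × (Fin f → ℝ))
    (hv : ∀ᶠ x in 𝓝 (t₀, ρ₀), v x = fderiv ℝ q x (1, 0))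
    (Dv : (ℝ × (Fin p → ℝ)) →L[ℝ] ((Fin m → ℝ) × (Fin f → ℝ)))
    (hDv : HasFDerivAt v Dv (t₀, ρ₀))
    (Φ : ℝ × ((Fin m → ℝ) × (Fin f → ℝ)) × (Fin p → ℝ) → Fin m → ℝ)
    (hΦ : ContDiffAt ℝ 2 Φ (t₀, q (t₀, ρ₀), ρ₀))
    (D2 : (ℝ × ((Fin m → ℝ) × (Fin f → ℝ)) × (Fin p → ℝ)) →L[ℝ]
      (ℝ × ((Fin m → ℝ) × (Fin f → ℝ)) × (Fin p → ℝ)) →L[ℝ] (Fin m → ℝ))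
    (hD2 : HasFDerivAt (fderiv ℝ Φ) D2 (t₀, q (t₀, ρ₀), ρ₀))
    (hvconstraint : ∀ᶠ x in 𝓝 (t₀, ρ₀),
      fderiv ℝ Φ (x.1, q x, x.2) (0, v x, 0) + fderiv ℝ Φ (x.1, q x, x.2) (1, 0, 0) = 0)
    (A : (Fin m → ℝ) ≃L[ℝ] (Fin m → ℝ))
    (hA : ∀ u, A u = fderiv ℝ Φ (t₀, q (t₀, ρ₀), ρ₀) (0, (u, 0), 0))
    (B : (Fin f → ℝ) →L[ℝ] (Fin m → ℝ))
    (hB : ∀ w, B w = fderiv ℝ Φ (t₀, q (t₀, ρ₀), ρ₀) (0, (0, w), 0))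
    (Q : (Fin p → ℝ) →L[ℝ] ((Fin m → ℝ) × (Fin f → ℝ)))
    (hQ : ∀ δρ, Q δρ = Dq (0, δρ))
    (Vdep : (Fin p → ℝ) →L[ℝ] (Fin m → ℝ)) (hVdep : ∀ δρ, Vdep δρ = (Dv (0, δρ)).1)
    (Vdof : (Fin p → ℝ) →L[ℝ] (Fin f → ℝ)) (hVdof : ∀ δρ, Vdof δρ = (Dv (0, δρ)).2) :
    ∀ δρ : Fin p → ℝ,
      Vdep δρ = - A.symm (B (Vdof δρ))
        - A.symm (D2 (0, Q δρ, 0) (0, v (t₀, ρ₀), 0)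
          + D2 (0, 0, δρ) (0, v (t₀, ρ₀), 0)
          + D2 (0, Q δρ, 0) (1, 0, 0)
          + D2 (0, 0, δρ) (1, 0, 0)) := by
  intro δρ
  have hγ : HasFDerivAt (fun x : ℝ × (Fin p → ℝ) => (x.1, q x, x.2))
      ((ContinuousLinearMap.fst ℝ ℝ (Fin p → ℝ)).prod
        (Dq.prod (ContinuousLinearMap.snd ℝ ℝ (Fin p → ℝ)))) (t₀, ρ₀) :=
    hasFDerivAt_fst.prodMk (hDq.prodMk hasFDerivAt_snd)
  have hw : HasFDerivAt (fun x : ℝ × (Fin p → ℝ) => ((1 : ℝ), v x, (0 : Fin p → ℝ)))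
      ((0 : (ℝ × (Fin p → ℝ)) →L[ℝ] ℝ).prod
        (Dv.prod (0 : (ℝ × (Fin p → ℝ)) →L[ℝ] (Fin p → ℝ)))) (t₀, ρ₀) :=
    (hasFDerivAt_const _ _).prodMk (hDv.prodMk (hasFDerivAt_const _ _))
  have hc : HasFDerivAt (fun x : ℝ × (Fin p → ℝ) => fderiv ℝ Φ (x.1, q x, x.2)) _ (t₀, ρ₀) :=
    HasFDerivAt.comp (t₀, ρ₀) (g := fderiv ℝ Φ) hD2 hγ
  have hg := hc.clm_apply hw
  have h0 : (fun x : ℝ × (Fin p → ℝ) =>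
      fderiv ℝ Φ (x.1, q x, x.2) ((1 : ℝ), v x, (0 : Fin p → ℝ))) =ᶠ[𝓝 (t₀, ρ₀)]
      fun _ => 0 := by
    filter_upwards [hvconstraint] with x hx
    rw [← hx, ← map_add]
    simp
  have hz := hg.unique ((hasFDerivAt_const (0 : Fin m → ℝ) (t₀, ρ₀)).congr_of_eventuallyEq h0)
  have key := congrArg (fun L => L (0, δρ)) hz
  simp at key
  have e1 : (0, Dv (0, δρ), 0) = ((0, (Vdep δρ, 0), 0) + (0, (0, Vdof δρ), 0) :
      ℝ × ((Fin m → ℝ) × (Fin f → ℝ)) × (Fin p → ℝ)) := by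
    simp [hVdep, hVdof]
  have e2 : (0, Dq (0, δρ), δρ) = ((0, Q δρ, 0) + (0, 0, δρ) :
      ℝ × ((Fin m → ℝ) × (Fin f → ℝ)) × (Fin p → ℝ)) := by
    simp [hQ]
  have e3 : (1, v (t₀, ρ₀), 0) = ((0, v (t₀, ρ₀), 0) + (1, 0, 0) :
      ℝ × ((Fin m → ℝ) × (Fin f → ℝ)) × (Fin p → ℝ)) := by
    simp
  rw [e1, e2, e3, map_add, map_add, map_add, ← hA, ← hB, add_apply,
    add_apply] at key
  apply A.injective
  simp only [map_sub, map_neg, ContinuousLinearEquiv.apply_symm_apply]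
  rw [← sub_eq_zero, ← key]
  abel
end

section
/- Jump in the independent velocity sensitivity for a constrained system whose equations of motion change at the event (transition function, continuous velocity). Let n, f, p be positive integers, ρ₀ ∈ ℝ^p, τ : ℝ^p → ℝ differentiable at ρ₀ with t* := τ(ρ₀). Let v⁻, v⁺ : ℝ × ℝ^p → ℝ^n be differentiable at (t*, ρ₀), with accelerations a± := ∂v±/∂t(t*,ρ₀) and velocity sensitivities V± := ∂v±/∂ρ(t*,ρ₀). Let P : ℝ^n → ℝ^f be a linear map (selection of the independent velocity coordinates). Assume the independent velocities are continuous across the event: P(v⁺(τ(ρ), ρ)) = P(v⁻(τ(ρ), ρ)) for all ρ in a neighborhood of ρ₀. Then for every δρ ∈ ℝ^p, P(V⁺(δρ)) = P(V⁻(δρ)) + P(a⁻ − a⁺) · (Dτ(ρ₀)(δρ)). -/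
open scoped Topology

/-- **Jump in the independent velocity sensitivity for a constrained system whose equations
of motion change at the event (continuous velocity).** If the independent velocity
components are continuous across the event, `P(v⁺(τ ρ, ρ)) = P(v⁻(τ ρ, ρ))` for `ρ` near
`ρ₀`, then `P(V⁺ δρ) = P(V⁻ δρ) + (Dτ(ρ₀)(δρ)) • P(a⁻ − a⁺)`. -/
theorem constrained_velocity_sensitivity_jump_transition
    {n f p : ℕ} (hn : 0 < n) (hf : 0 < f) (hp : 0 < p)
    (ρ₀ : Fin p → ℝ)
    (τ : (Fin p → ℝ) → ℝ) (Dτ : (Fin p → ℝ) →L[ℝ] ℝ)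
    (hτ : HasFDerivAt τ Dτ ρ₀)
    (vm vp : ℝ × (Fin p → ℝ) → Fin n → ℝ)
    (Dvm Dvp : (ℝ × (Fin p → ℝ)) →L[ℝ] (Fin n → ℝ))
    (hvm : HasFDerivAt vm Dvm (τ ρ₀, ρ₀))
    (hvp : HasFDerivAt vp Dvp (τ ρ₀, ρ₀))
    (am ap : Fin n → ℝ) (ham : am = Dvm (1, 0)) (hap : ap = Dvp (1, 0))
    (Vm Vp : (Fin p → ℝ) →L[ℝ] (Fin n → ℝ))
    (hVm : ∀ δρ, Vm δρ = Dvm (0, δρ))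
    (hVp : ∀ δρ, Vp δρ = Dvp (0, δρ))
    (P : (Fin n → ℝ) →ₗ[ℝ] (Fin f → ℝ))
    (hcont : ∀ᶠ ρ in 𝓝 ρ₀, P (vp (τ ρ, ρ)) = P (vm (τ ρ, ρ))) :
    ∀ δρ : Fin p → ℝ, P (Vp δρ) = P (Vm δρ) + Dτ δρ • P (am - ap) := by
  intro δρ
  have hg : HasFDerivAt (fun ρ => (τ ρ, ρ)) (Dτ.prod (ContinuousLinearMap.id ℝ (Fin p → ℝ))) ρ₀ :=
    hτ.prodMk (hasFDerivAt_id ρ₀)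
  have key : ∀ (v : ℝ × (Fin p → ℝ) → Fin n → ℝ) (D : (ℝ × (Fin p → ℝ)) →L[ℝ] (Fin n → ℝ)),
      HasFDerivAt v D (τ ρ₀, ρ₀) → HasFDerivAt (fun ρ => P (v (τ ρ, ρ)))
        ((LinearMap.toContinuousLinearMap P).comp
          (D.comp (Dτ.prod (ContinuousLinearMap.id ℝ (Fin p → ℝ))))) ρ₀ := by
    intro v D hv
    have h1 : HasFDerivAt (fun ρ => v (τ ρ, ρ)) _ ρ₀ := HasFDerivAt.comp ρ₀ hv hg
    exact (LinearMap.toContinuousLinearMap P).hasFDerivAt.comp ρ₀ h1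
  have heq := (key vp Dvp hvp).unique ((key vm Dvm hvm).congr_of_eventuallyEq hcont)
  have h := DFunLike.congr_fun heq δρ
  have split : ∀ D : (ℝ × (Fin p → ℝ)) →L[ℝ] (Fin n → ℝ),
      D (Dτ δρ, δρ) = Dτ δρ • D (1, 0) + D (0, δρ) := by
    intro D
    rw [← map_smul, ← map_add]
    simp
  simp only [ContinuousLinearMap.comp_apply, ContinuousLinearMap.prod_apply,
    ContinuousLinearMap.id_apply, LinearMap.coe_toContinuousLinearMap', split,
    map_add, map_smul] at h
  rw [hVm, hVp, ham, hap, map_sub, smul_sub]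
  rw [← sub_eq_zero] at h ⊢
  rw [← h]
  abel
end

section
/- Tangent linear model for the quadrature (running-cost) variable. Let n, p be positive integers, U ⊆ ℝ × ℝ^p open, f : ℝ × ℝ^n × ℝ^n × ℝ^p → ℝ^n continuously differentiable, q : ℝ × ℝ^p → ℝ^n three times continuously differentiable on U satisfying ∂²q/∂t² = f(t, q, ∂q/∂t, ρ) on U, with v := ∂q/∂t, Q := ∂q/∂ρ, V := ∂v/∂ρ. Let g : ℝ × ℝ^n × ℝ^n × ℝ^n × ℝ^p → ℝ be continuously differentiable and z : ℝ × ℝ^p → ℝ twice continuously differentiable on U with ∂z/∂t(t,ρ) = g(t, q(t,ρ), v(t,ρ), ∂v/∂t(t,ρ), ρ) on U. Define Z(t,ρ) := ∂z/∂ρ(t,ρ) ∈ L(ℝ^p, ℝ). Then for all (t,ρ) ∈ U, ∂Z/∂t = (g_q + g_{v̇} ∘ f_q) ∘ Q + (g_v + g_{v̇} ∘ f_v) ∘ V + g_ρ + g_{v̇} ∘ f_ρ, where g_q, g_v, g_{v̇}, g_ρ and f_q, f_v, f_ρ are the partial derivatives of g and f evaluated along the trajectory at (t, q(t,ρ), v(t,ρ),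 ∂v/∂t(t,ρ), ρ) and (t, q(t,ρ), v(t,ρ), ρ) respectively. -/
open scoped Topology

/-- **Tangent linear model for the quadrature (running-cost) variable.**
With `q` solving `∂²q/∂t² = f(t, q, ∂q/∂t, ρ)` on the open set `U`, `v := ∂q/∂t`,
`Q := ∂q/∂ρ`, `V := ∂v/∂ρ`, and `z` satisfying `∂z/∂t = g(t, q, v, ∂v/∂t, ρ)` on `U`, the
quadrature sensitivity `Z := ∂z/∂ρ` satisfies
`∂Z/∂t = (g_q + g_{v̇}∘f_q)∘Q + (g_v + g_{v̇}∘f_v)∘V + g_ρ + g_{v̇}∘f_ρ` on `U`. -/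
theorem tangent_linear_model_quadrature
    {n p : ℕ} (hn : 0 < n) (hp : 0 < p)
    (U : Set (ℝ × (Fin p → ℝ))) (hU : IsOpen U)
    (f : ℝ × (Fin n → ℝ) × (Fin n → ℝ) × (Fin p → ℝ) → Fin n → ℝ)
    (hf : ContDiff ℝ 1 f)
    (q : ℝ × (Fin p → ℝ) → Fin n → ℝ) (hq : ContDiffOn ℝ 3 q U)
    (v : ℝ × (Fin p → ℝ) → Fin n → ℝ)
    (hv : ∀ x ∈ U, v x = fderiv ℝ q x (1, 0))
    (heom : ∀ x ∈ U, fderiv ℝ v x (1, 0) = f (x.1, q x, v x, x.2))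
    (Q V : ℝ × (Fin p → ℝ) → (Fin p → ℝ) →L[ℝ] (Fin n → ℝ))
    (hQ : ∀ x ∈ U, Q x = (fderiv ℝ q x).comp (ContinuousLinearMap.inr ℝ ℝ (Fin p → ℝ)))
    (hV : ∀ x ∈ U, V x = (fderiv ℝ v x).comp (ContinuousLinearMap.inr ℝ ℝ (Fin p → ℝ)))
    (g : ℝ × (Fin n → ℝ) × (Fin n → ℝ) × (Fin n → ℝ) × (Fin p → ℝ) → ℝ)
    (hg : ContDiff ℝ 1 g)
    (z : ℝ × (Fin p → ℝ) → ℝ) (hz : ContDiffOn ℝ 2 z U)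
    (hzdot : ∀ x ∈ U,
      fderiv ℝ z x (1, 0) = g (x.1, q x, v x, fderiv ℝ v x (1, 0), x.2))
    (Z : ℝ × (Fin p → ℝ) → (Fin p → ℝ) →L[ℝ] ℝ)
    (hZ : ∀ x ∈ U, Z x = (fderiv ℝ z x).comp (ContinuousLinearMap.inr ℝ ℝ (Fin p → ℝ))) :
    ∀ x ∈ U, ∀ δρ : Fin p → ℝ,
      fderiv ℝ Z x (1, 0) δρ =
        fderiv ℝ g (x.1, q x, v x, fderiv ℝ v x (1, 0), x.2) (0, Q x δρ, 0, 0, 0)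
        + fderiv ℝ g (x.1, q x, v x, fderiv ℝ v x (1, 0), x.2)
            (0, 0, 0, fderiv ℝ f (x.1, q x, v x, x.2) (0, Q x δρ, 0, 0), 0)
        + fderiv ℝ g (x.1, q x, v x, fderiv ℝ v x (1, 0), x.2) (0, 0, V x δρ, 0, 0)
        + fderiv ℝ g (x.1, q x, v x, fderiv ℝ v x (1, 0), x.2)
            (0, 0, 0, fderiv ℝ f (x.1, q x, v x, x.2) (0, 0, V x δρ, 0), 0)
        + fderiv ℝ g (x.1, q x, v x, fderiv ℝ v x (1, 0), x.2) (0, 0, 0, 0, δρ)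
        + fderiv ℝ g (x.1, q x, v x, fderiv ℝ v x (1, 0), x.2)
            (0, 0, 0, fderiv ℝ f (x.1, q x, v x, x.2) (0, 0, 0, δρ), 0) := by
  intro x hx δρ
  have hUx : U ∈ 𝓝 x := hU.mem_nhds hx
  have hqx : ContDiffAt ℝ 3 q x := hq.contDiffAt hUx
  have hzx : ContDiffAt ℝ 2 z x := hz.contDiffAt hUx
  have hq1 : HasFDerivAt q (fderiv ℝ q x) x :=
    (hqx.differentiableAt (by norm_num)).hasFDerivAt
  have hdq : DifferentiableAt ℝ (fderiv ℝ q) x :=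
    (hqx.fderiv_right (m := 1) (by norm_num)).differentiableAt (by norm_num)
  have hdz : DifferentiableAt ℝ (fderiv ℝ z) x :=
    (hzx.fderiv_right (m := 1) (by norm_num)).differentiableAt (by norm_num)
  have hveq : v =ᶠ[𝓝 x] fun y => fderiv ℝ q y (1, 0) :=
    Filter.eventually_of_mem hUx hv
  have hv1 : HasFDerivAt v (fderiv ℝ v x) x :=
    ((hdq.clm_apply (differentiableAt_const _)).congr_of_eventuallyEq hveq).hasFDerivAt
  have hfst : HasFDerivAt (fun y : ℝ × (Fin p → ℝ) => y.1) _ x := hasFDerivAt_fst (𝕜 := ℝ)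
  have hsnd : HasFDerivAt (fun y : ℝ × (Fin p → ℝ) => y.2) _ x := hasFDerivAt_snd (𝕜 := ℝ)
  have hf1 : HasFDerivAt f (fderiv ℝ f (x.1, q x, v x, x.2)) (x.1, q x, v x, x.2) :=
    (hf.differentiable (by norm_num) _).hasFDerivAt
  have hF := HasFDerivAt.comp x hf1 (hfst.prodMk (hq1.prodMk (hv1.prodMk hsnd)))
  have hg1 : HasFDerivAt g (fderiv ℝ g (x.1, q x, v x, f (x.1, q x, v x, x.2), x.2))
      (x.1, q x, v x, f (x.1, q x, v x, x.2), x.2) :=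
    (hg.differentiable (by norm_num) _).hasFDerivAt
  have hG := HasFDerivAt.comp x hg1
    (hfst.prodMk (hq1.prodMk (hv1.prodMk (hF.prodMk hsnd))))
  have hzt := hdz.hasFDerivAt.clm_apply (hasFDerivAt_const ((1 : ℝ), (0 : Fin p → ℝ)) x)
  have hzeq : (fun y => fderiv ℝ z y (1, 0)) =ᶠ[𝓝 x]
      (g ∘ fun y => (y.1, q y, v y, (f ∘ fun y => (y.1, q y, v y, y.2)) y, y.2)) :=
    Filter.eventually_of_mem hUx fun y hy => by
      simp only [Function.comp]
      rw [hzdot y hy, heom y hy]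
  have key := hzt.unique (hG.congr_of_eventuallyEq hzeq)
  have key2 := congrArg (fun L => L ((0 : ℝ), δρ)) key
  have hsymm : IsSymmSndFDerivAt ℝ z x := hzx.isSymmSndFDerivAt (by simp)
  have hZeq : Z =ᶠ[𝓝 x] fun y => (fderiv ℝ z y).comp (ContinuousLinearMap.inr ℝ ℝ (Fin p → ℝ)) :=
    Filter.eventually_of_mem hUx hZ
  have hZ1 := (hdz.hasFDerivAt.clm_comp
    (hasFDerivAt_const (ContinuousLinearMap.inr ℝ ℝ (Fin p → ℝ)) x)).congr_of_eventuallyEq hZeq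
  have hL : fderiv ℝ Z x (1, 0) δρ = fderiv ℝ (fderiv ℝ z) x (0, δρ) (1, 0) := by
    rw [hZ1.fderiv, ← hsymm.eq]
    simp
  rw [hL, heom x hx, hQ x hx, hV x hx]
  simp at key2
  rw [key2]
  simp only [← map_add]
  simp [← map_add]
end

section
/- Correctness of the complex-step derivative approximation. Let f : ℂ → ℂ be complex differentiable at a real point x ∈ ℝ, and suppose f(x) ∈ ℝ (e.g., f is real-valued on the reals near x). Then the imaginary part of f evaluated at a complex perturbation of x recovers the real part of the derivative: lim_{h → 0, h ∈ ℝ \ {0}} Im(f(x + i·h))/h = Re(f'(x)). In particular, if f maps real numbers near x to real numbers, then f'(x) is real and lim_{h → 0} Im(f(x + i·h))/h = f'(x). -/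
open scoped Topology

/-- **Correctness of the complex-step derivative approximation.**
If `f : ℂ → ℂ` is complex differentiable at the real point `x` with `f x` real, then
`Im (f (x + i h)) / h → Re (f' x)` as the real perturbation `h → 0`.  In particular, if `f`
is real-valued on the reals near `x`, then `f' x` is real and the limit equals `f' x`. -/
theorem complex_step_derivative
    (f : ℂ → ℂ) (x : ℝ) (f' : ℂ)
    (hf : HasDerivAt f f' (x : ℂ))
    (hreal : (f (x : ℂ)).im = 0) :
    Filter.Tendsto (fun h : ℝ => (f ((x : ℂ) + Complex.I * (h : ℂ))).im / h)
      (𝓝[≠] (0 : ℝ)) (𝓝 f'.re)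
    ∧ ((∀ᶠ y : ℝ in 𝓝 x, (f (y : ℂ)).im = 0) →
        f'.im = 0 ∧
        Filter.Tendsto (fun h : ℝ => (f ((x : ℂ) + Complex.I * (h : ℂ))).im / h)
          (𝓝[≠] (0 : ℝ)) (𝓝 f'.re)) := by
  have key : Filter.Tendsto (fun h : ℝ => (f ((x : ℂ) + Complex.I * (h : ℂ))).im / h)
      (𝓝[≠] (0 : ℝ)) (𝓝 f'.re) := by
    have h1 : HasDerivAt (fun h : ℝ => (x : ℂ) + Complex.I * (h : ℂ)) Complex.I 0 := by
      have h0 : HasDerivAt (fun h : ℝ => (h : ℂ)) 1 0 := Complex.ofRealCLM.hasDerivAt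
      simpa using (h0.const_mul Complex.I).const_add (x : ℂ)
    have hf2 : HasDerivAt f f' ((fun h : ℝ => (x : ℂ) + Complex.I * (h : ℂ)) 0) := by
      simpa using hf
    have h2 := hf2.comp_of_eq (0 : ℝ) h1 rfl
    have h3 : HasDerivAt (fun h : ℝ => (f ((x : ℂ) + Complex.I * (h : ℂ))).im) f'.re 0 := by
      have := Complex.imCLM.hasFDerivAt.comp_hasDerivAt (0 : ℝ) h2
      simpa [Function.comp_def] using this
    have h4 := h3.tendsto_slope_zero
    refine h4.congr fun h => ?_
    simp [hreal, div_eq_inv_mul]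
  refine ⟨key, fun hev => ⟨?_, key⟩⟩
  have h0 : HasDerivAt (fun y : ℝ => (y : ℂ)) 1 x := Complex.ofRealCLM.hasDerivAt
  have h2 := hf.comp_of_eq x h0 rfl
  have h3 : HasDerivAt (fun y : ℝ => (f (y : ℂ)).im) f'.im x := by
    have := Complex.imCLM.hasFDerivAt.comp_hasDerivAt x h2
    simpa [Function.comp_def] using this
  exact h3.unique ((hasDerivAt_const x (0 : ℝ)).congr_of_eventuallyEq hev)
end
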